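/- Define g(x, z) = 2x(e^{sz} − 1) / ((s − 1)e^{sz} + s + 1) with s = √(1 − 2x), on the open set of pairs (x, z) ∈ ℝ² with 0 < x < 1/2 for which the denominator (s − 1)e^{sz} + s + 1 is nonzero. Then g satisfies the first-order partial differential equation x(1 − 2x)·∂g/∂x + (xz − 1)·∂g/∂z = −x·g − x at every point of this set. -/

import Mathlib

open Real

/-- The closed-form generating function
`g(x,z) = 2x(e^{sz} − 1)/((s − 1)e^{sz} + s + 1)`, `s = √(1 − 2x)`. -/
noncomputable def gfun (x z : ℝ) : ℝ :=
  2 * x * (Real.exp (Real.sqrt (1 - 2 * x) * z) - 1) /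
    ((Real.sqrt (1 - 2 * x) - 1) * Real.exp (Real.sqrt (1 - 2 * x) * z)
      + Real.sqrt (1 - 2 * x) + 1)

/-- On the open set `0 < x < 1/2`, denominator `≠ 0`, the function `g`
satisfies the characteristic PDE
`x(1 − 2x)·∂g/∂x + (xz − 1)·∂g/∂z = −x·g − x`. -/
theorem gfun_pde (x z : ℝ) (hx0 : 0 < x) (hx1 : x < 1 / 2)
    (hden : (Real.sqrt (1 - 2 * x) - 1) * Real.exp (Real.sqrt (1 - 2 * x) * z)
      + Real.sqrt (1 - 2 * x) + 1 ≠ 0) :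
    x * (1 - 2 * x) * deriv (fun u => gfun u z) x
      + (x * z - 1) * deriv (fun w => gfun x w) z
      = -x * gfun x z - x := by
  have hpos : 0 < 1 - 2 * x := by linarith
  have hs : 0 < Real.sqrt (1 - 2 * x) := Real.sqrt_pos.mpr hpos
  have hsq : Real.sqrt (1 - 2 * x) ^ 2 = 1 - 2 * x := Real.sq_sqrt hpos.le
  have h1 : HasDerivAt (fun u : ℝ => Real.sqrt (1 - 2 * u))
      (-1 / Real.sqrt (1 - 2 * x)) x := by
    have h := (((hasDerivAt_id x).const_mul 2).const_sub 1).sqrt hpos.ne'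
    refine HasDerivAt.congr_deriv h ?_
    change -(2 * 1) / (2 * Real.sqrt (1 - 2 * x)) = -1 / Real.sqrt (1 - 2 * x)
    field_simp
  have h2 := (h1.mul_const z).exp
  have h3 := (((hasDerivAt_id x).const_mul 2).mul (h2.sub_const 1)).div
    ((((h1.sub_const 1).mul h2).add h1).add_const 1) hden
  have k2 := ((hasDerivAt_id z).const_mul (Real.sqrt (1 - 2 * x))).exp
  have k3 := ((k2.sub_const 1).const_mul (2 * x)).div
    (((k2.const_mul (Real.sqrt (1 - 2 * x) - 1)).add_const
      (Real.sqrt (1 - 2 * x))).add_const 1) hden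
  have e1 : deriv (fun u => gfun u z) x = _ := h3.deriv
  have e2 : deriv (fun w => gfun x w) z = _ := k3.deriv
  rw [e1, e2]
  simp only [gfun, id, Pi.mul_apply, Pi.add_apply]
  clear e1 e2 h1 h2 h3 k2 k3
  generalize Real.exp (Real.sqrt (1 - 2 * x) * z) = E at *
  generalize Real.sqrt (1 - 2 * x) = s at *
  have hx : x = (1 - s ^ 2) / 2 := by linarith
  have hs0 := hs.ne'
  subst hx
  clear hsq hpos hx0 hx1 hs
  generalize hD : (s - 1) * E + s + 1 = D at *
  field_simp
  subst hD
  ring
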